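/- Let 0 < T < S < 1. Then there exists r₀ > 0 such that for every r > r₀ one has F(r)² − 4·E(r)·G(r) > 0 and there exists an integer n with −4 ≤ n ≤ 4 (depending on r) such that (Q_{S,T}(r) − π/(√(1−T)·√(1−S)·√(1−√T)·√(1−√S)))·√(F(r)²−4E(r)G(r)) = 2·i·n·π·√((1−√T)(1−√S))·√r·(1+r), as an identity of complex numbers. -/

import Mathlib

open MeasureTheory

/-- `R = 2r(1−√T)(1−√S)`. -/
noncomputable def Rc (S T r : ℝ) : ℝ := 2 * r * (1 - Real.sqrt T) * (1 - Real.sqrt S)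

/-- `E(r) = (√T+√S−2√S√T)² + 2R√S√T`. -/
noncomputable def Ec (S T r : ℝ) : ℝ :=
  (Real.sqrt T + Real.sqrt S - 2 * Real.sqrt S * Real.sqrt T) ^ 2 +
    2 * Rc S T r * Real.sqrt S * Real.sqrt T

/-- `F(r) = 2(√T+√S−2)(√T+√S−2√S√T) + 2R(1+√S√T−2√T−2√S) + R²`. -/
noncomputable def Fc (S T r : ℝ) : ℝ :=
  2 * (Real.sqrt T + Real.sqrt S - 2) *
      (Real.sqrt T + Real.sqrt S - 2 * Real.sqrt S * Real.sqrt T) +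
    2 * Rc S T r * (1 + Real.sqrt S * Real.sqrt T - 2 * Real.sqrt T - 2 * Real.sqrt S) +
    Rc S T r ^ 2

/-- `G(r) = (√T+√S−2)² + 2R`. -/
noncomputable def Gc (S T r : ℝ) : ℝ :=
  (Real.sqrt T + Real.sqrt S - 2) ^ 2 + 2 * Rc S T r

/-- `I₂(r,z) = (√T+√S−2√S√T + R√z + z(√T+√S−2))/(E(r)+F(r)z+G(r)z²)`. -/
noncomputable def I2c (S T r z : ℝ) : ℝ :=
  (Real.sqrt T + Real.sqrt S - 2 * Real.sqrt S * Real.sqrt T + Rc S T r * Real.sqrt z +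
      z * (Real.sqrt T + Real.sqrt S - 2)) /
    (Ec S T r + Fc S T r * z + Gc S T r * z ^ 2)

/-- `Q_{S,T}(r) = (1+r)·∫_T^S I₂(r,z)/((1+√z)√(√z−√T)√(√S−√z)) dz`. -/
noncomputable def Qc (S T r : ℝ) : ℝ :=
  (1 + r) * ∫ z in T..S, I2c S T r z /
    ((1 + Real.sqrt z) * Real.sqrt (Real.sqrt z - Real.sqrt T) *
      Real.sqrt (Real.sqrt S - Real.sqrt z))

/-- The numerator polynomial of the integrand, with a = √T, b = √S, u = √z. -/
noncomputable def auxN (a b R u : ℝ) : ℝ := a + b - 2 * b * a + R * u + u ^ 2 * (a + b - 2)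

/-- The denominator polynomial. -/
noncomputable def auxD (a b R u : ℝ) : ℝ :=
  ((a + b - 2 * b * a) ^ 2 + 2 * R * b * a) +
  (2 * (a + b - 2) * (a + b - 2 * b * a) + 2 * R * (1 + b * a - 2 * a - 2 * b) + R ^ 2) * u ^ 2 +
  ((a + b - 2) ^ 2 + 2 * R) * u ^ 4

/-- The weight. -/
noncomputable def auxW (a b u : ℝ) : ℝ := Real.sqrt (u - a) * Real.sqrt (b - u)

/-- The Möbius map carrying a, b to -1, 1. -/
noncomputable def auxM (a b u : ℝ) : ℝ :=
  ((2 + a + b) - 2 * (1 + a) * (1 + b) / (1 + u)) / (b - a)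

/-- The polynomial whose square differs from auxD by a multiple of the squared weight. -/
noncomputable def auxL (a b R u : ℝ) : ℝ :=
  a + b + 2 * b * a + (R - 4 * (a + b)) * u + u ^ 2 * (a + b + 2)

/-- The primitive. -/
noncomputable def auxP (a b R u : ℝ) : ℝ :=
  1 / ((1 - a) * (1 - b)) * (Real.arcsin (auxM a b u) / Real.sqrt ((1 + a) * (1 + b)) -
    1 / Real.sqrt (2 * (R - 4 * (a + b))) *
      (Real.log (auxL a b R u + Real.sqrt (2 * (R - 4 * (a + b))) * (1 - u) * auxW a b u) -
       Real.log (auxL a b R u - Real.sqrt (2 * (R - 4 * (a + b))) * (1 - u) * auxW a b u)))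

lemma aux_factor (a b R u : ℝ) : auxD a b R u =
    auxL a b R u ^ 2 - 2 * (R - 4 * (a + b)) * (1 - u) ^ 2 * ((u - a) * (b - u)) := by
  unfold auxD auxL; ring

lemma auxW_sq (a b u : ℝ) (h1 : a ≤ u) (h2 : u ≤ b) : auxW a b u ^ 2 = (u - a) * (b - u) := by
  unfold auxW
  rw [mul_pow, Real.sq_sqrt (by linarith), Real.sq_sqrt (by linarith)]

lemma aux_F (a b R : ℝ) (ha : 0 < a) (hb : b < 1) (hab : a < b) (hR : 20 ≤ R) :
    R ^ 2 / 2 ≤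
    (2 * (a + b - 2) * (a + b - 2 * b * a) + 2 * R * (1 + b * a - 2 * a - 2 * b) + R ^ 2) := by
  have hp0 : 0 ≤ a + b - 2 * b * a := by nlinarith
  have hp1 : a + b - 2 * b * a ≤ 1 := by nlinarith
  have h2 : -4 ≤ 1 + b * a - 2 * a - 2 * b := by nlinarith
  have h3 : -4 ≤ 2 * (a + b - 2) * (a + b - 2 * b * a) := by nlinarith
  nlinarith

lemma aux_disc (a b R : ℝ) (ha : 0 < a) (hb : b < 1) (hab : a < b) (hR : 20 ≤ R) :
    0 < (2 * (a + b - 2) * (a + b - 2 * b * a) + 2 * R * (1 + b * a - 2 * a - 2 * b) + R ^ 2) ^ 2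
     - 4 * ((a + b - 2 * b * a) ^ 2 + 2 * R * b * a) * ((a + b - 2) ^ 2 + 2 * R) := by
  have hF := aux_F a b R ha hb hab hR
  have hp0 : 0 ≤ a + b - 2 * b * a := by nlinarith
  have hp1 : a + b - 2 * b * a ≤ 1 := by nlinarith
  have hba : b * a ≤ 1 := by nlinarith
  have hba0 : 0 ≤ b * a := by nlinarith
  have hE : (a + b - 2 * b * a) ^ 2 + 2 * R * b * a ≤ 1 + 2 * R := by nlinarith
  have hE0 : 0 ≤ (a + b - 2 * b * a) ^ 2 + 2 * R * b * a := by
    have : 0 ≤ R * (b * a) := by positivity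
    nlinarith [sq_nonneg (a + b - 2 * b * a)]
  have hG : (a + b - 2) ^ 2 + 2 * R ≤ 4 + 2 * R := by nlinarith
  have hG0 : 0 ≤ (a + b - 2) ^ 2 + 2 * R := by positivity
  have hEG := mul_le_mul hE hG hG0 (by linarith)
  have hFF := pow_le_pow_left₀ (by positivity) hF 2
  have : 4 * ((1 + 2 * R) * (4 + 2 * R)) < (R ^ 2 / 2) ^ 2 := by
    have : 400 ≤ R ^ 2 := by nlinarith
    nlinarith
  linarith

lemma auxD_pos (a b R u : ℝ) (ha : 0 < a) (hb : b < 1) (hab : a < b) (hR : 20 ≤ R) :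
    0 < auxD a b R u := by
  have hF := aux_F a b R ha hb hab hR
  have hE : 0 < (a + b - 2 * b * a) ^ 2 + 2 * R * b * a := by
    have : 0 < R * (b * a) := by have : 0 < b := by linarith
                                 positivity
    nlinarith [sq_nonneg (a + b - 2 * b * a)]
  have hF0 := le_trans (by positivity : 0 ≤ R ^ 2 / 2) hF
  unfold auxD
  have := mul_nonneg hF0 (sq_nonneg u)
  have : 0 ≤ ((a + b - 2) ^ 2 + 2 * R) * u ^ 4 := by positivity
  linarith

lemma auxN_pos (a b R u : ℝ) (ha : 0 < a) (hb : b < 1) (hab : a < b) (hR : 20 ≤ R)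
    (h1 : a ≤ u) (h2 : u ≤ b) : 0 < auxN a b R u := by
  unfold auxN
  have hp0 : 0 ≤ a + b - 2 * b * a := by nlinarith
  have hu : 0 < u := by linarith
  have : 0 < u * (R + u * (a + b - 2)) := mul_pos hu (by nlinarith)
  nlinarith

lemma auxL_pos (a b R u : ℝ) (ha : 0 < a) (hb : b < 1) (hab : a < b) (hR : 20 ≤ R)
    (h1 : a ≤ u) : 0 < auxL a b R u := by
  unfold auxL
  have hu : 0 < u := by linarith
  have hb0 : 0 < b := by linarith
  have : 0 < R - 4 * (a + b) := by linarith
  positivity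

lemma aux_sub_pos (a b R u : ℝ) (ha : 0 < a) (hb : b < 1) (hab : a < b) (hR : 20 ≤ R)
    (h1 : a ≤ u) (h2 : u ≤ b) :
    0 < auxL a b R u - Real.sqrt (2 * (R - 4 * (a + b))) * (1 - u) * auxW a b u := by
  have hD := auxD_pos a b R u ha hb hab hR
  have hN := auxL_pos a b R u ha hb hab hR h1
  rw [aux_factor, ← auxW_sq a b u h1 h2] at hD
  have hs : Real.sqrt (2 * (R - 4 * (a + b))) ^ 2 = 2 * (R - 4 * (a + b)) := Real.sq_sqrt (by linarith)
  rw [sub_pos]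
  apply lt_of_pow_lt_pow_left₀ 2 hN.le
  rw [mul_pow, mul_pow, hs]
  linarith

lemma aux_add_pos (a b R u : ℝ) (ha : 0 < a) (hb : b < 1) (hab : a < b) (hR : 20 ≤ R)
    (h1 : a ≤ u) (h2 : u ≤ b) :
    0 < auxL a b R u + Real.sqrt (2 * (R - 4 * (a + b))) * (1 - u) * auxW a b u := by
  have hN := auxL_pos a b R u ha hb hab hR h1
  have : 0 ≤ auxW a b u := by unfold auxW; positivity
  have : 0 ≤ 1 - u := by linarith
  positivity

lemma aux_one_sub_M (a b u : ℝ) (ha : 0 < a) (hab : a < b) (h1 : a ≤ u) (h2 : u ≤ b) :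
    1 - auxM a b u ^ 2 =
      (2 * Real.sqrt ((1 + a) * (1 + b)) * auxW a b u / ((b - a) * (1 + u))) ^ 2 := by
  have hk : Real.sqrt ((1 + a) * (1 + b)) ^ 2 = (1 + a) * (1 + b) :=
    Real.sq_sqrt (mul_nonneg (by linarith) (by linarith))
  rw [div_pow, mul_pow, mul_pow, hk, auxW_sq a b u h1 h2]
  unfold auxM
  have h3 : b - a ≠ 0 := by linarith
  have h4 : 1 + u ≠ 0 := by linarith
  field_simp
  ring

lemma auxW_deriv (a b u : ℝ) (h1 : a < u) (h2 : u < b) :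
    HasDerivAt (auxW a b) ((a + b - 2 * u) / (2 * auxW a b u)) u := by
  have e1 : HasDerivAt (fun x => Real.sqrt (x - a)) (1 / (2 * Real.sqrt (u - a))) u :=
    ((hasDerivAt_id u).sub_const a).sqrt (by simp; linarith)
  have e2 : HasDerivAt (fun x => Real.sqrt (b - x)) (-1 / (2 * Real.sqrt (b - u))) u :=
    ((hasDerivAt_id u).const_sub b).sqrt (by simp; linarith)
  have e3 := e1.mul e2
  have p1 : 0 < Real.sqrt (u - a) := Real.sqrt_pos.2 (by linarith)
  have p2 : 0 < Real.sqrt (b - u) := Real.sqrt_pos.2 (by linarith)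
  have q1 : Real.sqrt (u - a) ^ 2 = u - a := Real.sq_sqrt (by linarith)
  have q2 : Real.sqrt (b - u) ^ 2 = b - u := Real.sq_sqrt (by linarith)
  refine e3.congr_deriv ?_
  unfold auxW
  field_simp
  rw [q1, q2]; ring

lemma auxP_deriv (a b r u : ℝ) (ha : 0 < a) (hb : b < 1) (hab : a < b)
    (hR : 20 ≤ 2 * r * (1 - a) * (1 - b)) (h1 : a < u) (h2 : u < b) :
    HasDerivAt (auxP a b (2 * r * (1 - a) * (1 - b)))
      ((1 + r) * (2 * u) * auxN a b (2 * r * (1 - a) * (1 - b)) u /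
        (auxD a b (2 * r * (1 - a) * (1 - b)) u * (1 + u) * auxW a b u)) u := by
  obtain ⟨R, hRdef⟩ : ∃ R, R = 2 * r * (1 - a) * (1 - b) := ⟨_, rfl⟩
  rw [← hRdef] at hR ⊢
  have hW := auxW_deriv a b u h1 h2
  have hWp : 0 < auxW a b u :=
    mul_pos (Real.sqrt_pos.2 (by linarith)) (Real.sqrt_pos.2 (by linarith))
  have hWsq := auxW_sq a b u h1.le h2.le
  have hadd := aux_add_pos a b R u ha hb hab hR h1.le h2.le
  have hsub := aux_sub_pos a b R u ha hb hab hR h1.le h2.le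
  have hDp := auxD_pos a b R u ha hb hab hR
  have hfac := aux_factor a b R u
  have hs : Real.sqrt (2 * (R - 4 * (a + b))) ^ 2 = 2 * (R - 4 * (a + b)) := Real.sq_sqrt (by linarith)
  have hsp : 0 < Real.sqrt (2 * (R - 4 * (a + b))) := Real.sqrt_pos.2 (by linarith)
  have hkp : 0 < Real.sqrt ((1 + a) * (1 + b)) :=
    Real.sqrt_pos.2 (mul_pos (by linarith) (by linarith))
  have hk : Real.sqrt ((1 + a) * (1 + b)) ^ 2 = (1 + a) * (1 + b) :=
    Real.sq_sqrt (mul_nonneg (by linarith) (by linarith))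
  have hu : 0 < 1 + u := by linarith
  have hba : 0 < b - a := by linarith
  have hN : HasDerivAt (auxL a b R) ((R - 4 * (a + b)) + 2 * u * (a + b + 2)) u := by
    have := (((hasDerivAt_id u).const_mul (R - 4 * (a + b))).const_add (a + b + 2 * b * a)).add
      (((hasDerivAt_id u).pow 2).mul_const (a + b + 2))
    refine this.congr_deriv ?_
    simp
  have hX : HasDerivAt (fun x => Real.sqrt (2 * (R - 4 * (a + b))) * (1 - x) * auxW a b x)
      (Real.sqrt (2 * (R - 4 * (a + b))) * (-auxW a b u + (1 - u) * ((a + b - 2 * u) / (2 * auxW a b u)))) u := by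
    have := (((hasDerivAt_id u).const_sub 1).const_mul (Real.sqrt (2 * (R - 4 * (a + b))))).mul hW
    refine this.congr_deriv ?_
    simp; ring
  have hL := ((hN.add hX).log hadd.ne').sub ((hN.sub hX).log hsub.ne')
  have hMd : HasDerivAt (auxM a b) (2 * (1 + a) * (1 + b) / (1 + u) ^ 2 / (b - a)) u := by
    have := ((((hasDerivAt_const u (2 * (1 + a) * (1 + b))).div
      ((hasDerivAt_id u).const_add 1) hu.ne').const_sub (2 + a + b))).div_const (b - a)
    refine this.congr_deriv ?_
    simp; ring
  have h1M := aux_one_sub_M a b u ha hab h1.le h2.le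
  have hpos : 0 < 2 * Real.sqrt ((1 + a) * (1 + b)) * auxW a b u / ((b - a) * (1 + u)) := by
    positivity
  have hM1 : 0 < 1 - auxM a b u ^ 2 := by rw [h1M]; positivity
  have hA := (Real.hasDerivAt_arcsin (x := auxM a b u) (by intro h; rw [h] at hM1; norm_num at hM1)
    (by intro h; rw [h] at hM1; norm_num at hM1)).comp u hMd
  have hAll := ((hA.div_const (Real.sqrt ((1 + a) * (1 + b)))).sub
    (hL.const_mul (1 / Real.sqrt (2 * (R - 4 * (a + b)))))).const_mul (1 / ((1 - a) * (1 - b)))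
  refine hAll.congr_deriv ?_
  rw [h1M, Real.sqrt_sq hpos.le]
  have hc1 : 0 < 1 - a := by linarith
  have hc2 : 0 < 1 - b := by linarith
  have ea : 1 / (2 * Real.sqrt ((1 + a) * (1 + b)) * auxW a b u / ((b - a) * (1 + u))) *
      (2 * (1 + a) * (1 + b) / (1 + u) ^ 2 / (b - a)) / Real.sqrt ((1 + a) * (1 + b)) =
      1 / ((1 + u) * auxW a b u) := by
    field_simp
    linarith
  rw [ea]
  have hprod : (auxL a b R u + Real.sqrt (2 * (R - 4 * (a + b))) * (1 - u) * auxW a b u) *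
      (auxL a b R u - Real.sqrt (2 * (R - 4 * (a + b))) * (1 - u) * auxW a b u) = auxD a b R u := by
    rw [hfac, ← hWsq]; linear_combination (-(1 - u) ^ 2 * auxW a b u ^ 2) * hs
  have el : 1 / Real.sqrt (2 * (R - 4 * (a + b))) * (((R - 4 * (a + b)) + 2 * u * (a + b + 2) +
        Real.sqrt (2 * (R - 4 * (a + b))) * (-auxW a b u + (1 - u) * ((a + b - 2 * u) / (2 * auxW a b u)))) /
        (auxL a b R u + Real.sqrt (2 * (R - 4 * (a + b))) * (1 - u) * auxW a b u) -
      ((R - 4 * (a + b)) + 2 * u * (a + b + 2) -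
        Real.sqrt (2 * (R - 4 * (a + b))) * (-auxW a b u + (1 - u) * ((a + b - 2 * u) / (2 * auxW a b u)))) /
        (auxL a b R u - Real.sqrt (2 * (R - 4 * (a + b))) * (1 - u) * auxW a b u)) =
      (-2 * ((u - a) * (b - u)) * auxL a b R u + (1 - u) * (a + b - 2 * u) * auxL a b R u
        - 2 * (1 - u) * ((u - a) * (b - u)) * ((R - 4 * (a + b)) + 2 * u * (a + b + 2))) /
        (auxD a b R u * auxW a b u) := by
    rw [← hprod, ← hWsq, div_sub_div _ _ hadd.ne' hsub.ne']
    have hne := mul_ne_zero hadd.ne' hsub.ne'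
    rw [one_div, inv_mul_eq_div, div_div, div_eq_div_iff (by positivity) (by positivity)]
    field_simp
    ring
  simp only [Pi.add_apply, Pi.sub_apply] at *
  rw [el]
  have hr : (1 - a) * (1 - b) * (1 + r) = (1 - a) * (1 - b) + R / 2 := by rw [hRdef]; ring
  have hpoly : auxD a b R u - (1 + u) * (-2 * ((u - a) * (b - u)) * auxL a b R u +
      (1 - u) * (a + b - 2 * u) * auxL a b R u
        - 2 * (1 - u) * ((u - a) * (b - u)) * ((R - 4 * (a + b)) + 2 * u * (a + b + 2))) =
      ((1 - a) * (1 - b) * (1 + r)) * (2 * u) * auxN a b R u := by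
    rw [hr]; unfold auxD auxN auxL; ring
  have : (1 + r) * (2 * u) * auxN a b R u = 1 / ((1 - a) * (1 - b)) *
      (((1 - a) * (1 - b) * (1 + r)) * (2 * u) * auxN a b R u) := by
    field_simp
  rw [this, ← hpoly]
  generalize auxL a b R u = L at *
  generalize auxD a b R u = D at *
  generalize auxW a b u = W at *
  field_simp

lemma auxP_cont (a b R : ℝ) (ha : 0 < a) (hb : b < 1) (hab : a < b) (hR : 20 ≤ R) :
    ContinuousOn (auxP a b R) (Set.Icc a b) := by
  have hW : Continuous (auxW a b) := by unfold auxW; fun_prop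
  have hN : Continuous (auxL a b R) := by unfold auxL; fun_prop
  have hM : ContinuousOn (auxM a b) (Set.Icc a b) := by
    unfold auxM
    refine ContinuousOn.div_const (ContinuousOn.sub continuousOn_const
      (ContinuousOn.div continuousOn_const (by fun_prop) ?_)) _
    intro x hx; have := hx.1; linarith
  unfold auxP
  refine ContinuousOn.mul continuousOn_const (ContinuousOn.sub
    ((Real.continuous_arcsin.comp_continuousOn hM).div_const _)
    (continuousOn_const.mul (ContinuousOn.sub (ContinuousOn.log (by fun_prop) ?_)
      (ContinuousOn.log (by fun_prop) ?_))))
  · intro x hx; exact (aux_add_pos a b R x ha hb hab hR hx.1 hx.2).ne'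
  · intro x hx; exact (aux_sub_pos a b R x ha hb hab hR hx.1 hx.2).ne'

lemma auxP_ends (a b R : ℝ) (ha : 0 < a) (hab : a < b) :
    auxP a b R b - auxP a b R a =
      Real.pi / ((1 - a) * (1 - b) * Real.sqrt ((1 + a) * (1 + b))) := by
  have h1 : auxM a b a = -1 := by
    unfold auxM
    have h3 : b - a ≠ 0 := by linarith
    have h4 : 1 + a ≠ 0 := by linarith
    field_simp
    ring
  have h2 : auxM a b b = 1 := by
    unfold auxM
    have h3 : b - a ≠ 0 := by linarith
    have h4 : 1 + b ≠ 0 := by linarith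
    field_simp
    ring
  have h3 : auxW a b a = 0 := by simp [auxW]
  have h4 : auxW a b b = 0 := by simp [auxW]
  unfold auxP
  rw [h1, h2, h3, h4, Real.arcsin_one, Real.arcsin_neg_one]
  simp only [mul_zero, add_zero, sub_zero, sub_self]
  rw [← mul_sub, ← sub_div, ← mul_div_assoc, div_mul_eq_mul_div, div_div]
  congr 1
  ring

lemma aux_main (T S r : ℝ) (hT : 0 < T) (hTS : T < S) (hS : S < 1) (hR : 20 ≤ Rc S T r) :
    Qc S T r = Real.pi / (Real.sqrt (1 - T) * Real.sqrt (1 - S) *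
            Real.sqrt (1 - Real.sqrt T) * Real.sqrt (1 - Real.sqrt S)) := by
  obtain ⟨a, haT⟩ : ∃ a, a = Real.sqrt T := ⟨_, rfl⟩
  obtain ⟨b, hbS⟩ : ∃ b, b = Real.sqrt S := ⟨_, rfl⟩
  have ha : 0 < a := by rw [haT]; exact Real.sqrt_pos.2 hT
  have hab : a < b := by rw [haT, hbS]; exact Real.sqrt_lt_sqrt hT.le hTS
  have hb : b < 1 := by rw [hbS, Real.sqrt_lt' one_pos]; simpa using hS
  have haq : T = a ^ 2 := by rw [haT, Real.sq_sqrt hT.le]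
  have hbq : S = b ^ 2 := by rw [hbS, Real.sq_sqrt (hT.trans hTS).le]
  have hR' : 20 ≤ 2 * r * (1 - a) * (1 - b) := by rw [haT, hbS]; exact hR
  have hr : 0 < r := by
    have : 0 < (1 - a) * (1 - b) := mul_pos (by linarith) (by linarith)
    by_contra h
    nlinarith
  have hmem : ∀ z ∈ Set.Icc T S, Real.sqrt z ∈ Set.Icc a b := by
    intro z hz
    rw [haT, hbS]
    exact ⟨Real.sqrt_le_sqrt hz.1, Real.sqrt_le_sqrt hz.2⟩
  have hcont : ContinuousOn (fun z => auxP a b (2 * r * (1 - a) * (1 - b)) (Real.sqrt z))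
      (Set.Icc T S) :=
    (auxP_cont a b _ ha hb hab hR').comp Real.continuous_sqrt.continuousOn hmem
  have hderiv : ∀ z ∈ Set.Ioo T S,
      HasDerivAt (fun z => auxP a b (2 * r * (1 - a) * (1 - b)) (Real.sqrt z))
      ((1 + r) * (I2c S T r z / ((1 + Real.sqrt z) * Real.sqrt (Real.sqrt z - Real.sqrt T) *
      Real.sqrt (Real.sqrt S - Real.sqrt z)))) z := by
    intro z hz
    have hz0 : 0 < z := hT.trans hz.1
    have hza : a < Real.sqrt z := by rw [haT]; exact Real.sqrt_lt_sqrt hT.le hz.1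
    have hzb : Real.sqrt z < b := by rw [hbS]; exact Real.sqrt_lt_sqrt hz0.le hz.2
    have := (auxP_deriv a b r _ ha hb hab hR' hza hzb).comp z (Real.hasDerivAt_sqrt hz0.ne')
    refine this.congr_deriv ?_
    have hI : I2c S T r z = auxN a b (2 * r * (1 - a) * (1 - b)) (Real.sqrt z) /
        auxD a b (2 * r * (1 - a) * (1 - b)) (Real.sqrt z) := by
      unfold I2c Ec Fc Gc Rc auxN auxD
      have h4 : Real.sqrt z ^ 4 = z ^ 2 := by
        rw [show (4 : ℕ) = 2 * 2 by norm_num, pow_mul, Real.sq_sqrt hz0.le]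
      rw [Real.sq_sqrt hz0.le, h4, haT, hbS]
    rw [hI, ← haT, ← hbS]
    have hD := auxD_pos a b _ (Real.sqrt z) ha hb hab hR'
    have p1 : 0 < Real.sqrt (Real.sqrt z - a) := Real.sqrt_pos.2 (by linarith)
    have p2 : 0 < Real.sqrt (b - Real.sqrt z) := Real.sqrt_pos.2 (by linarith)
    have p3 : 0 < Real.sqrt z := ha.trans hza
    unfold auxW
    generalize auxN a b (2 * r * (1 - a) * (1 - b)) (Real.sqrt z) = N at *
    generalize auxD a b (2 * r * (1 - a) * (1 - b)) (Real.sqrt z) = D at *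
    field_simp
  have hnn : ∀ z ∈ Set.Ioo T S, 0 ≤ ((1 + r) * (I2c S T r z / ((1 + Real.sqrt z) *
      Real.sqrt (Real.sqrt z - Real.sqrt T) * Real.sqrt (Real.sqrt S - Real.sqrt z)))) := by
    intro z hz
    have hz0 : 0 < z := hT.trans hz.1
    have hm := hmem z ⟨hz.1.le, hz.2.le⟩
    have hI : I2c S T r z = auxN a b (2 * r * (1 - a) * (1 - b)) (Real.sqrt z) /
        auxD a b (2 * r * (1 - a) * (1 - b)) (Real.sqrt z) := by
      unfold I2c Ec Fc Gc Rc auxN auxD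
      have h4 : Real.sqrt z ^ 4 = z ^ 2 := by
        rw [show (4 : ℕ) = 2 * 2 by norm_num, pow_mul, Real.sq_sqrt hz0.le]
      rw [Real.sq_sqrt hz0.le, h4, haT, hbS]
    rw [hI]
    have hD := auxD_pos a b _ (Real.sqrt z) ha hb hab hR'
    have hN := auxN_pos a b _ (Real.sqrt z) ha hb hab hR' hm.1 hm.2
    positivity
  have hintegr := intervalIntegral.integrableOn_deriv_of_nonneg hcont hderiv hnn
  have hftc := intervalIntegral.integral_eq_sub_of_hasDerivAt_of_le hTS.le hcont hderiv
    ((intervalIntegrable_iff_integrableOn_Ioc_of_le hTS.le).2 hintegr)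
  unfold Qc
  rw [← intervalIntegral.integral_const_mul, hftc, ← haT, ← hbS, auxP_ends a b _ ha hab]
  congr 1
  have e1 : Real.sqrt (1 - T) = Real.sqrt (1 - a) * Real.sqrt (1 + a) := by
    rw [← Real.sqrt_mul (by linarith), haq]; congr 1; ring
  have e2 : Real.sqrt (1 - S) = Real.sqrt (1 - b) * Real.sqrt (1 + b) := by
    rw [← Real.sqrt_mul (by linarith), hbq]; congr 1; ring
  rw [e1, e2, Real.sqrt_mul (by linarith)]
  have q1 : Real.sqrt (1 - a) ^ 2 = 1 - a := Real.sq_sqrt (by linarith)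
  have q2 : Real.sqrt (1 - b) ^ 2 = 1 - b := Real.sq_sqrt (by linarith)
  calc (1 - a) * (1 - b) * (Real.sqrt (1 + a) * Real.sqrt (1 + b))
      = Real.sqrt (1 - a) ^ 2 * Real.sqrt (1 - b) ^ 2 *
        (Real.sqrt (1 + a) * Real.sqrt (1 + b)) := by rw [q1, q2]
    _ = _ := by ring

theorem stmt_18 (T S : ℝ) (hT : 0 < T) (hTS : T < S) (hS : S < 1) :
    ∃ r₀ > (0 : ℝ), ∀ r > r₀,
      Fc S T r ^ 2 - 4 * Ec S T r * Gc S T r > 0 ∧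
      ∃ n : ℤ, -4 ≤ n ∧ n ≤ 4 ∧
        (((Qc S T r - Real.pi / (Real.sqrt (1 - T) * Real.sqrt (1 - S) *
            Real.sqrt (1 - Real.sqrt T) * Real.sqrt (1 - Real.sqrt S))) : ℝ) : ℂ) *
          ((Real.sqrt (Fc S T r ^ 2 - 4 * Ec S T r * Gc S T r) : ℝ) : ℂ) =
        2 * Complex.I * (n : ℂ) * (Real.pi : ℂ) *
          ((Real.sqrt ((1 - Real.sqrt T) * (1 - Real.sqrt S)) : ℝ) : ℂ) *
          ((Real.sqrt r : ℝ) : ℂ) * ((1 + r : ℝ) : ℂ) := by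
  have ha1 : 0 < 1 - Real.sqrt T := by
    rw [sub_pos, Real.sqrt_lt' one_pos]; linarith
  have hb1 : 0 < 1 - Real.sqrt S := by
    rw [sub_pos, Real.sqrt_lt' one_pos]; linarith
  have hc : 0 < (1 - Real.sqrt T) * (1 - Real.sqrt S) := mul_pos ha1 hb1
  refine ⟨10 / ((1 - Real.sqrt T) * (1 - Real.sqrt S)), by positivity, ?_⟩
  intro r hr
  have hR : 20 ≤ Rc S T r := by
    have := (div_lt_iff₀ hc).1 hr
    unfold Rc
    linarith
  constructor
  · exact aux_disc (Real.sqrt T) (Real.sqrt S) (Rc S T r) (Real.sqrt_pos.2 hT) (by linarith)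
      (Real.sqrt_lt_sqrt hT.le hTS) hR
  · refine ⟨0, by norm_num, by norm_num, ?_⟩
    rw [aux_main T S r hT hTS hS hR]
    simp
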